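/- arXiv:2305.11642 — 5 statements merged into one kernel-verified Lean document; each statement's English description precedes it below -/
import Mathlib

section
/- Let n ≥ 1, N = 2^n, U an N×N complex unitary matrix, P_in and P_out N×N Hermitian idempotent matrices of ranks r_in ≥ 1 and r_out ≥ 1, and O_in, O_out N×N unitaries diagonalizing them as P_in = O_in† · diag(I_{r_in}, 0) · O_in and P_out = O_out · diag(I_{r_out}, 0) · O_out†. Set ñ = ⌈log₂ max(r_in, r_out)⌉. Then there exists a 2^ñ × 2^ñ complex matrix Ṽ such that P_out · U · P_in = O_out · ((|0⟩⟨0|)^{⊗(n-ñ)} ⊗ Ṽ) · O_in, where ⊗ is the Kronecker product and (|0⟩⟨0|)^{⊗(n-ñ)} is the (n-ñ)-fold Kronecker power of the 2×2 matrix diag(1,0). Consequently the conjugation channel [P_out · U · P_in] equals the channel [O_out · ((|0⟩⟨0|)^{⊗(n-ñ)} ⊗ Ṽ) · O_in]. (Theorem 1 of the paper.) -/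
open Matrix
open scoped Matrix Kronecker

noncomputable section

/-- Kronecker product of square complex matrices, with the standard lexicographic
identification `Fin m × Fin n ≃ Fin (m * n)` (left factor most significant). -/
def kron {m n : ℕ} (A : Matrix (Fin m) (Fin m) ℂ) (B : Matrix (Fin n) (Fin n) ℂ) :
    Matrix (Fin (m * n)) (Fin (m * n)) ℂ :=
  Matrix.reindex finProdFinEquiv finProdFinEquiv (A ⊗ₖ B)

/-- Transport a square matrix along an equality of dimensions. -/
def castM {a b : ℕ} (h : a = b) (A : Matrix (Fin a) (Fin a) ℂ) : Matrix (Fin b) (Fin b) ℂ :=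
  Matrix.reindex (finCongr h) (finCongr h) A

theorem pow2mul {a b c : ℕ} (h : a + b = c) : 2 ^ a * 2 ^ b = 2 ^ c := by
  rw [← pow_add, h]

def ket0bra0 : Matrix (Fin 2) (Fin 2) ℂ := !![1, 0; 0, 0]
def ket1bra1 : Matrix (Fin 2) (Fin 2) ℂ := !![0, 0; 0, 1]
def PauliX : Matrix (Fin 2) (Fin 2) ℂ := !![0, 1; 1, 0]
def PauliY : Matrix (Fin 2) (Fin 2) ℂ := !![0, -Complex.I; Complex.I, 0]
def PauliZ : Matrix (Fin 2) (Fin 2) ℂ := !![1, 0; 0, -1]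

/-- `n`-fold Kronecker product of one-qubit matrices, `f 0` being the leftmost factor. -/
def kronPow : (k : ℕ) → (Fin k → Matrix (Fin 2) (Fin 2) ℂ) →
    Matrix (Fin (2 ^ k)) (Fin (2 ^ k)) ℂ
  | 0, _ => 1
  | k + 1, f => castM (pow2mul (Nat.one_add k)) (kron (f 0) (kronPow k fun i => f i.succ))

/-- `(|0⟩⟨0|)^{⊗ k}`. -/
def projPow (k : ℕ) : Matrix (Fin (2 ^ k)) (Fin (2 ^ k)) ℂ := kronPow k fun _ => ket0bra0

/-- Diagonal projection with the first `r` diagonal entries equal to 1. -/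
def diagProj (N r : ℕ) : Matrix (Fin N) (Fin N) ℂ :=
  Matrix.diagonal fun i => if (i : ℕ) < r then 1 else 0

/-- The sixteen Table-1 basis matrices (0-indexed). -/
def tableV : Fin 16 → Matrix (Fin 2) (Fin 2) ℂ :=
  ![1, PauliX, PauliY, PauliZ,
    ((Real.sqrt 2 : ℝ) : ℂ)⁻¹ • (1 + Complex.I • PauliX),
    ((Real.sqrt 2 : ℝ) : ℂ)⁻¹ • (1 + Complex.I • PauliY),
    ((Real.sqrt 2 : ℝ) : ℂ)⁻¹ • (1 + Complex.I • PauliZ),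
    ((Real.sqrt 2 : ℝ) : ℂ)⁻¹ • (PauliY + PauliZ),
    ((Real.sqrt 2 : ℝ) : ℂ)⁻¹ • (PauliZ + PauliX),
    ((Real.sqrt 2 : ℝ) : ℂ)⁻¹ • (PauliX + PauliY),
    (2 : ℂ)⁻¹ • (1 + PauliX),
    (2 : ℂ)⁻¹ • (1 + PauliY),
    (2 : ℂ)⁻¹ • (1 + PauliZ),
    (2 : ℂ)⁻¹ • (PauliY + Complex.I • PauliZ),
    (2 : ℂ)⁻¹ • (PauliZ + Complex.I • PauliX),
    (2 : ℂ)⁻¹ • (PauliX + Complex.I • PauliY)]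


/-- A Kronecker product with the leading rank-one diagonal projection is block diagonal, with
`B` in the top-left block and zeros elsewhere. -/
theorem castM_kron_diagProj_one_apply {m n c : ℕ} (h : m * n = c)
    (B : Matrix (Fin n) (Fin n) ℂ) (i j : Fin c) :
    castM h (kron (diagProj m 1) B) i j =
      if hij : (i : ℕ) < n ∧ (j : ℕ) < n then B ⟨i, hij.1⟩ ⟨j, hij.2⟩ else 0 := by
  subst h
  obtain ⟨⟨a, b⟩, rfl⟩ := finProdFinEquiv.surjective i
  obtain ⟨⟨a', b'⟩, rfl⟩ := finProdFinEquiv.surjective j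
  have key : ∀ (x : Fin m) (y : Fin n), ((finProdFinEquiv (x, y) : ℕ) < n ↔ (x : ℕ) = 0) := by
    intro x y
    rw [finProdFinEquiv_apply_val]
    constructor
    · intro hlt
      by_contra hx
      have := Nat.le_mul_of_pos_right n (Nat.pos_of_ne_zero hx)
      dsimp only at hlt
      omega
    · intro hx
      simp [hx]
  have hentry : castM rfl (kron (diagProj m 1) B) (finProdFinEquiv (a, b))
      (finProdFinEquiv (a', b')) = diagProj m 1 a a' * B b b' := by
    simp [castM, kron, -finProdFinEquiv_apply_val, -finProdFinEquiv_symm_apply]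
  rw [hentry]
  split_ifs with hij
  · have ha := (key a b).1 hij.1
    have ha' := (key a' b').1 hij.2
    have haa : a = a' := Fin.ext (ha.trans ha'.symm)
    subst haa
    simp [diagProj, ha]
  · rw [key, key] at hij
    by_cases haa : a = a'
    · subst haa
      simp [diagProj, show (a : ℕ) ≠ 0 by tauto]
    · simp [diagProj, haa]

theorem ket0bra0_eq_diagProj : ket0bra0 = diagProj 2 1 := by
  ext i j
  fin_cases i <;> fin_cases j <;> simp [ket0bra0, diagProj]

theorem projPow_eq_diagProj (k : ℕ) : projPow k = diagProj (2 ^ k) 1 := by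
  induction k with
  | zero =>
    ext i j
    simp [projPow, kronPow, diagProj, Matrix.one_apply, Matrix.diagonal_apply]
  | succ k ih =>
    have hstep : projPow (k + 1) =
        castM (pow2mul (Nat.one_add k)) (kron ket0bra0 (projPow k)) := rfl
    rw [hstep, ih, ket0bra0_eq_diagProj]
    ext i j
    refine (castM_kron_diagProj_one_apply (m := 2) _ _ i j).trans ?_
    have hpos : 0 < 2 ^ k := by positivity
    simp only [diagProj, Matrix.diagonal_apply, Fin.ext_iff]
    split_ifs <;> first | rfl | omega

theorem diagProj_mul_mul_diagProj_apply {N : ℕ} (r s : ℕ) (M : Matrix (Fin N) (Fin N) ℂ)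
    (i j : Fin N) :
    (diagProj N r * M * diagProj N s) i j =
      if (i : ℕ) < r ∧ (j : ℕ) < s then M i j else 0 := by
  rw [diagProj, diagProj, Matrix.mul_diagonal, Matrix.diagonal_mul]
  split_ifs <;> simp_all

theorem diagProj_mul_mul_diagProj_eq_kron {m n c r s : ℕ} (h : m * n = c) (hn : n ≤ c)
    (hr : r ≤ n) (hs : s ≤ n) (M : Matrix (Fin c) (Fin c) ℂ) :
    diagProj c r * M * diagProj c s =
      castM h (kron (diagProj m 1)
        ((diagProj c r * M * diagProj c s).submatrix (Fin.castLE hn) (Fin.castLE hn))) := by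
  ext i j
  rw [castM_kron_diagProj_one_apply]
  split_ifs with hij
  · rfl
  · rw [diagProj_mul_mul_diagProj_apply, if_neg]
    omega

/-- Theorem 1 of the paper. -/
theorem stmt1 (n rin rout : ℕ) (hn : 1 ≤ n) (hrin : 1 ≤ rin) (hrout : 1 ≤ rout)
    (U Pin Pout Oin Oout : Matrix (Fin (2 ^ n)) (Fin (2 ^ n)) ℂ)
    (hU : U ∈ Matrix.unitaryGroup (Fin (2 ^ n)) ℂ)
    (hOin : Oin ∈ Matrix.unitaryGroup (Fin (2 ^ n)) ℂ)
    (hOout : Oout ∈ Matrix.unitaryGroup (Fin (2 ^ n)) ℂ)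
    (hPinH : Pinᴴ = Pin) (hPinIdem : Pin * Pin = Pin) (hPinRank : Pin.rank = rin)
    (hPoutH : Poutᴴ = Pout) (hPoutIdem : Pout * Pout = Pout) (hPoutRank : Pout.rank = rout)
    (hdin : Pin = Oinᴴ * diagProj (2 ^ n) rin * Oin)
    (hdout : Pout = Oout * diagProj (2 ^ n) rout * Ooutᴴ) :
    ∃ (hdim : 2 ^ (n - Nat.clog 2 (max rin rout)) * 2 ^ Nat.clog 2 (max rin rout) = 2 ^ n)
      (Vt : Matrix (Fin (2 ^ Nat.clog 2 (max rin rout)))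
              (Fin (2 ^ Nat.clog 2 (max rin rout))) ℂ),
      Pout * U * Pin
          = Oout * castM hdim (kron (projPow (n - Nat.clog 2 (max rin rout))) Vt) * Oin
      ∧ ∀ ρ : Matrix (Fin (2 ^ n)) (Fin (2 ^ n)) ℂ,
          (Pout * U * Pin) * ρ * (Pout * U * Pin)ᴴ
            = (Oout * castM hdim (kron (projPow (n - Nat.clog 2 (max rin rout))) Vt) * Oin) * ρ *
              (Oout * castM hdim (kron (projPow (n - Nat.clog 2 (max rin rout))) Vt) * Oin)ᴴ := by
  have hrank (A : Matrix (Fin (2 ^ n)) (Fin (2 ^ n)) ℂ) : A.rank ≤ 2 ^ n := by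
    simpa using A.rank_le_card_width
  have hmax : max rin rout ≤ 2 ^ n := max_le (hPinRank ▸ hrank Pin) (hPoutRank ▸ hrank Pout)
  have hclog : Nat.clog 2 (max rin rout) ≤ n := Nat.clog_le_of_le_pow hmax
  have hle : max rin rout ≤ 2 ^ Nat.clog 2 (max rin rout) := Nat.le_pow_clog one_lt_two _
  have hdim := pow2mul (Nat.sub_add_cancel hclog)
  have heq := diagProj_mul_mul_diagProj_eq_kron hdim (Nat.pow_le_pow_right two_pos hclog)
    ((le_max_right _ _).trans hle) ((le_max_left _ _).trans hle) (Ooutᴴ * U * Oinᴴ)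
  rw [← projPow_eq_diagProj] at heq
  have hmain : Pout * U * Pin = Oout *
      (diagProj (2 ^ n) rout * (Ooutᴴ * U * Oinᴴ) * diagProj (2 ^ n) rin) * Oin := by
    rw [hdin, hdout]
    simp only [Matrix.mul_assoc]
  rw [heq] at hmain
  exact ⟨hdim, _, hmain, fun ρ => by rw [hmain]⟩

end
end

section
/- Let n ≥ 2, N = 2^n, U an N×N complex unitary matrix, and 0 ≤ m ≤ n−1. Define P_in = (|0⟩⟨0|)^{⊗(m+1)} ⊗ I_{2^{n-m-1}} and P_out = |1⟩⟨1| ⊗ (|0⟩⟨0|)^{⊗ m} ⊗ I_{2^{n-m-1}}, and set r = 2^{n-m-1}. Then P_out · U · P_in = (X ⊗ I_{2^{n-1}}) · ((|0⟩⟨0|)^{⊗(m+1)} ⊗ Ṽ), where Ṽ is the r×r matrix with entries Ṽ_{ij} = U_{2^{n-1}+i, j} for 0 ≤ i, j < r, X is the Pauli-X matrix [[0,1],[1,0]], and |1⟩⟨1| denotes the 2×2 matrix diag(0,1). (Corollary 2 of the paper.) -/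
open Matrix
open scoped Matrix Kronecker

noncomputable section

/-- `P_in = (|0⟩⟨0|)^{⊗(m+1)} ⊗ I_{2^{n-m-1}}`. -/
def cor2Pin (n m : ℕ) (h : m + 1 ≤ n) : Matrix (Fin (2 ^ n)) (Fin (2 ^ n)) ℂ :=
  castM (pow2mul (by omega))
    (kron (projPow (m + 1)) (1 : Matrix (Fin (2 ^ (n - m - 1))) (Fin (2 ^ (n - m - 1))) ℂ))

/-- `P_out = |1⟩⟨1| ⊗ (|0⟩⟨0|)^{⊗ m} ⊗ I_{2^{n-m-1}}`. -/
def cor2Pout (n m : ℕ) (h : m + 1 ≤ n) : Matrix (Fin (2 ^ n)) (Fin (2 ^ n)) ℂ :=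
  castM (pow2mul (by omega : 1 + (n - 1) = n))
    (kron ket1bra1
      (castM (pow2mul (by omega))
        (kron (projPow m)
          (1 : Matrix (Fin (2 ^ (n - m - 1))) (Fin (2 ^ (n - m - 1))) ℂ))))

/-- The effective matrix `Ṽ` of Corollary 2, with entries `Ṽ_{ij} = U_{2^{n-1}+i, j}`. -/
def cor2V (n m : ℕ) (hn : 2 ≤ n) (h : m + 1 ≤ n) (U : Matrix (Fin (2 ^ n)) (Fin (2 ^ n)) ℂ) :
    Matrix (Fin (2 ^ (n - m - 1))) (Fin (2 ^ (n - m - 1))) ℂ :=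
  fun i j =>
    U ⟨2 ^ (n - 1) + (i : ℕ), by
        have h1 : (i : ℕ) < 2 ^ (n - m - 1) := i.isLt
        have h2 : (2 : ℕ) ^ (n - m - 1) ≤ 2 ^ (n - 1) :=
          Nat.pow_le_pow_right (by norm_num) (by omega)
        have h3 : (2 : ℕ) ^ (n - 1) + 2 ^ (n - 1) = 2 ^ n := by
          have := pow2mul (by omega : 1 + (n - 1) = n)
          omega
        omega⟩
      (Fin.castLE (Nat.pow_le_pow_right (by norm_num) (by omega)) j)

theorem castM_kron_apply {a b c : ℕ} (h : a * b = c) (A : Matrix (Fin a) (Fin a) ℂ)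
    (B : Matrix (Fin b) (Fin b) ℂ) (i j : Fin c) :
    castM h (kron A B) i j =
      A ((i.cast h.symm).divNat) ((j.cast h.symm).divNat) *
        B ((i.cast h.symm).modNat) ((j.cast h.symm).modNat) := by
  rfl

theorem projPow_apply (k : ℕ) (i j : Fin (2 ^ k)) :
    projPow k i j = if (i : ℕ) = 0 ∧ (j : ℕ) = 0 then 1 else 0 := by
  induction k with
  | zero =>
    have hi : (i : ℕ) = 0 := by have := i.isLt; simp at this ⊢
    have hj : (j : ℕ) = 0 := by have := j.isLt; simp at this ⊢
    have hij : i = j := Fin.ext (hi.trans hj.symm)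
    rw [hij, if_pos ⟨hj, hj⟩]
    exact Matrix.one_apply_eq j
  | succ k ih =>
    have hket : ∀ x y : Fin 2,
        ket0bra0 x y = if (x : ℕ) = 0 ∧ (y : ℕ) = 0 then 1 else 0 := by
      intro x y
      fin_cases x <;> fin_cases y <;> simp [ket0bra0]
    have hsplit : projPow (k + 1) =
        castM (pow2mul (Nat.one_add k)) (kron ket0bra0 (projPow k)) := rfl
    have hzero : ∀ x : ℕ, x = 0 ↔ x / 2 ^ k = 0 ∧ x % 2 ^ k = 0 := by
      intro x
      constructor
      · rintro rfl
        simp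
      · rintro ⟨hd, hm⟩
        rw [← Nat.div_add_mod x (2 ^ k), hd, hm, mul_zero]
    rw [hsplit, castM_kron_apply, ih]
    erw [hket]
    rw [ite_zero_mul_ite_zero, one_mul]
    refine if_congr ?_ rfl rfl
    rw [hzero i, hzero j]
    simp only [Fin.coe_divNat, Fin.coe_modNat, Fin.val_cast]
    tauto

theorem castM_kron_projPow_apply {k r c : ℕ} (h : 2 ^ k * r = c)
    (A : Matrix (Fin r) (Fin r) ℂ) (i j : Fin c) :
    castM h (kron (projPow k) A) i j =
      if hij : (i : ℕ) < r ∧ (j : ℕ) < r then A ⟨i, hij.1⟩ ⟨j, hij.2⟩ else 0 := by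
  have hr : 0 < r := by
    rcases Nat.eq_zero_or_pos r with rfl | hr
    · exact absurd i.isLt (by simp [← h])
    · exact hr
  rw [castM_kron_apply, projPow_apply]
  simp only [Fin.coe_divNat, Fin.val_cast, Nat.div_eq_zero_iff, hr.ne', false_or]
  split_ifs with hij
  · rw [one_mul]
    congr 1 <;> ext <;> simp [Nat.mod_eq_of_lt, hij.1, hij.2]
  · rw [zero_mul]

theorem castM_kron_projPow_one {k r c : ℕ} (h : 2 ^ k * r = c) :
    castM h (kron (projPow k) (1 : Matrix (Fin r) (Fin r) ℂ)) = diagProj c r := by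
  ext i j
  rw [castM_kron_projPow_apply, diagProj, Matrix.diagonal_apply]
  by_cases hij : i = j
  · subst hij
    simp
  · simp [Fin.val_inj, hij]

theorem castM_kron_ket1bra1_diagProj {b c r : ℕ} (h : 2 ^ 1 * b = c) :
    castM h (kron ket1bra1 (diagProj b r)) =
      Matrix.diagonal fun i : Fin c => if b ≤ (i : ℕ) ∧ (i : ℕ) < b + r then 1 else 0 := by
  ext i j
  have hket : ∀ x y : Fin 2,
      ket1bra1 x y = if (x : ℕ) = 1 ∧ (y : ℕ) = 1 then 1 else 0 := by
    intro x y
    fin_cases x <;> fin_cases y <;> simp [ket1bra1]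
  have hb : 0 < b := by have := i.isLt; omega
  have hdiv : ∀ x : Fin c, (x : ℕ) / b = 1 ↔ b ≤ (x : ℕ) := by
    intro x
    have := x.isLt
    rw [Nat.div_eq_iff hb]
    omega
  have hmod : ∀ x : Fin c, b ≤ (x : ℕ) → (x : ℕ) % b = x - b := by
    intro x hx
    have := x.isLt
    rw [Nat.mod_eq_sub_mod hx, Nat.mod_eq_of_lt (by omega)]
  rw [castM_kron_apply, diagProj, Matrix.diagonal_apply, Matrix.diagonal_apply]
  erw [hket]
  simp only [Fin.coe_divNat, Fin.coe_modNat, Fin.val_cast, Fin.ext_iff, hdiv]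
  by_cases hi : b ≤ (i : ℕ)
  · by_cases hj : b ≤ (j : ℕ)
    · have hi' := hmod i hi
      have hj' := hmod j hj
      simp only [hi, hj, and_self, if_true, one_mul, true_and]
      refine if_congr (by omega) (if_congr (by omega) rfl rfl) rfl
    · have hij : (i : ℕ) ≠ j := by omega
      simp [hj, hij]
  · simp [hi]

theorem castM_kron_PauliX_one_mul_apply {b c : ℕ} (h : 2 ^ 1 * b = c)
    (A : Matrix (Fin c) (Fin c) ℂ) (i j k : Fin c)
    (hik : (i : ℕ) = k + b ∨ (k : ℕ) = i + b) :
    (castM h (kron PauliX (1 : Matrix (Fin b) (Fin b) ℂ)) * A) i j = A k j := by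
  have hX : ∀ x y : Fin 2, PauliX x y = if (x : ℕ) + y = 1 then 1 else 0 := by
    intro x y
    fin_cases x <;> fin_cases y <;> simp [PauliX]
  have hb : 0 < b := by have := i.isLt; omega
  have hentry : ∀ l : Fin c, castM h (kron PauliX (1 : Matrix (Fin b) (Fin b) ℂ)) i l =
      if l = k then 1 else 0 := by
    intro l
    rw [castM_kron_apply, Matrix.one_apply]
    erw [hX]
    rw [ite_zero_mul_ite_zero, one_mul]
    refine if_congr ?_ rfl rfl
    simp only [Fin.coe_divNat, Fin.coe_modNat, Fin.val_cast, Fin.ext_iff]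
    have hvals : ∀ x : Fin c, ((x : ℕ) < b ∧ (x : ℕ) / b = 0 ∧ (x : ℕ) % b = x) ∨
        (b ≤ (x : ℕ) ∧ (x : ℕ) / b = 1 ∧ (x : ℕ) % b = x - b) := by
      intro x
      rcases lt_or_ge (x : ℕ) b with hx | hx
      · exact Or.inl ⟨hx, Nat.div_eq_of_lt hx, Nat.mod_eq_of_lt hx⟩
      · have := x.isLt
        refine Or.inr ⟨hx, (Nat.div_eq_iff hb).2 (by omega), ?_⟩
        rw [Nat.mod_eq_sub_mod hx, Nat.mod_eq_of_lt (by omega)]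
    have hi := i.isLt
    have hk := k.isLt
    have hl := l.isLt
    rcases hvals i with ⟨hi₁, hi₂, hi₃⟩ | ⟨hi₁, hi₂, hi₃⟩ <;>
      rcases hvals l with ⟨hl₁, hl₂, hl₃⟩ | ⟨hl₁, hl₂, hl₃⟩ <;>
      rw [hi₂, hi₃, hl₂, hl₃] <;> omega
  simp [Matrix.mul_apply, hentry]

/-- Corollary 2 of the paper. -/
theorem stmt5 (n m : ℕ) (hn : 2 ≤ n) (hm : m ≤ n - 1)
    (U : Matrix (Fin (2 ^ n)) (Fin (2 ^ n)) ℂ)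
    (hU : U ∈ Matrix.unitaryGroup (Fin (2 ^ n)) ℂ) :
    cor2Pout n m (by omega) * U * cor2Pin n m (by omega)
      = castM (pow2mul (by omega : 1 + (n - 1) = n))
          (kron PauliX (1 : Matrix (Fin (2 ^ (n - 1))) (Fin (2 ^ (n - 1))) ℂ)) *
        castM (pow2mul (by omega))
          (kron (projPow (m + 1)) (cor2V n m hn (by omega) U)) := by
  have hpow : 2 ^ 1 * 2 ^ (n - 1) = 2 ^ n := pow2mul (by omega)
  have hle : 2 ^ (n - m - 1) ≤ 2 ^ (n - 1) := Nat.pow_le_pow_right (by norm_num) (by omega)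
  rw [cor2Pout, cor2Pin, castM_kron_projPow_one, castM_kron_projPow_one,
    castM_kron_ket1bra1_diagProj, diagProj]
  ext i j
  have hi := i.isLt
  rw [Matrix.mul_diagonal, Matrix.diagonal_mul]
  rcases lt_or_ge (i : ℕ) (2 ^ (n - 1)) with hlt | hge
  · rw [castM_kron_PauliX_one_mul_apply _ _ i j ⟨i + 2 ^ (n - 1), by omega⟩ (Or.inr rfl),
      castM_kron_projPow_apply, dif_neg (by simp only; omega), if_neg (by omega)]
    simp
  · rw [castM_kron_PauliX_one_mul_apply _ _ i j ⟨i - 2 ^ (n - 1), by omega⟩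
        (Or.inl (by simp only; omega)), castM_kron_projPow_apply]
    by_cases hij : (i : ℕ) - 2 ^ (n - 1) < 2 ^ (n - m - 1) ∧ (j : ℕ) < 2 ^ (n - m - 1)
    · rw [dif_pos hij, if_pos (by omega), if_pos hij.2, one_mul, mul_one, cor2V]
      congr 1
      ext
      simp only
      omega
    · rw [dif_neg hij]
      by_cases hj : (j : ℕ) < 2 ^ (n - m - 1)
      · rw [if_neg (by omega)]
        simp
      · simp [hj]

end
end

section
/- For every 2×2 complex matrix W there exist real numbers c₁, …, c₁₆ such that for all 2×2 complex matrices ρ: W ρ W† = Σ_{i=1}^{16} c_i · V_i ρ V_i†, where V₁, …, V₁₆ are the Table-1 basis matrices. In other words, the real span of the sixteen conjugation channels [V_i] contains every one-qubit conjugation channel [W]. -/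
open Matrix
open scoped Matrix Kronecker

noncomputable section

theorem pauliX_conjTranspose : PauliXᴴ = PauliX := by
  ext i j; fin_cases i <;> fin_cases j <;> simp [PauliX]

theorem pauliY_conjTranspose : PauliYᴴ = PauliY := by
  ext i j; fin_cases i <;> fin_cases j <;> simp [PauliY]

theorem pauliZ_conjTranspose : PauliZᴴ = PauliZ := by
  ext i j; fin_cases i <;> fin_cases j <;> simp [PauliZ]

theorem eq_pauli_combination (W : Matrix (Fin 2) (Fin 2) ℂ) :
    ∃ x y : Fin 4 → ℝ, W =
      (x 0 + y 0 * Complex.I : ℂ) • 1 + (x 1 + y 1 * Complex.I : ℂ) • PauliX +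
      (x 2 + y 2 * Complex.I : ℂ) • PauliY + (x 3 + y 3 * Complex.I : ℂ) • PauliZ := by
  let w : Fin 4 → ℂ := ![(W 0 0 + W 1 1) / 2, (W 0 1 + W 1 0) / 2,
    Complex.I * (W 0 1 - W 1 0) / 2, (W 0 0 - W 1 1) / 2]
  refine ⟨fun a => (w a).re, fun a => (w a).im, ?_⟩
  simp only [Complex.re_add_im]
  ext i j
  fin_cases i <;> fin_cases j <;> simp [w, PauliX, PauliY, PauliZ]
  · ring
  · linear_combination (W 0 1 - W 1 0) / 2 * Complex.I_sq
  · linear_combination -(W 0 1 - W 1 0) / 2 * Complex.I_sq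
  · ring

/-- Conjugation by a matrix scaled by `√2⁻¹`, with the two scalars collected. -/
theorem inv_sqrt_two_smul_conj {n : Type*} [Fintype n] (A ρ : Matrix n n ℂ) :
    (((Real.sqrt 2 : ℝ) : ℂ)⁻¹ • A) * ρ * (((Real.sqrt 2 : ℝ) : ℂ)⁻¹ • A)ᴴ =
      (2 : ℂ)⁻¹ • (A * ρ * Aᴴ) := by
  have h : ((Real.sqrt 2 : ℝ) : ℂ)⁻¹ * ((Real.sqrt 2 : ℝ) : ℂ)⁻¹ = (2 : ℂ)⁻¹ := by
    rw [← mul_inv, ← Complex.ofReal_mul, Real.mul_self_sqrt (by norm_num)]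
    norm_num
  rw [conjTranspose_smul, smul_mul_assoc, smul_mul_assoc, mul_smul_comm, smul_smul]
  simp [h]

/-- every one-qubit conjugation channel lies in the real span of the
sixteen Table-1 conjugation channels. -/
theorem stmt6 (W : Matrix (Fin 2) (Fin 2) ℂ) :
    ∃ c : Fin 16 → ℝ, ∀ ρ : Matrix (Fin 2) (Fin 2) ℂ,
      W * ρ * Wᴴ = ∑ i : Fin 16, (c i : ℂ) • (tableV i * ρ * (tableV i)ᴴ) := by
  obtain ⟨x, y, rfl⟩ := eq_pauli_combination W
  let r : Fin 4 → Fin 4 → ℝ := fun a b => x a * x b + y a * y b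
  let s : Fin 4 → Fin 4 → ℝ := fun a b => y a * x b - x a * y b
  let d : Fin 4 → Fin 4 → ℝ := fun a b => s a b - r a b
  refine ⟨![r 0 0 + d 0 1 + d 0 2 + d 0 3, r 1 1 + d 0 1 + d 1 2 + d 3 1,
    r 2 2 + d 0 2 + d 1 2 + d 2 3, r 3 3 + d 0 3 + d 2 3 + d 3 1,
    -2 * s 0 1, -2 * s 0 2, -2 * s 0 3, 2 * r 2 3, 2 * r 3 1, 2 * r 1 2,
    4 * r 0 1, 4 * r 0 2, 4 * r 0 3, -4 * s 2 3, -4 * s 3 1, -4 * s 1 2], fun ρ => ?_⟩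
  simp only [Fin.sum_univ_succ, Fin.sum_univ_zero, tableV, cons_val_zero, cons_val_succ,
    inv_sqrt_two_smul_conj]
  simp only [conjTranspose_add, conjTranspose_smul, conjTranspose_one, pauliX_conjTranspose,
    pauliY_conjTranspose, pauliZ_conjTranspose, add_mul, mul_add, smul_mul_assoc,
    mul_smul_comm, one_mul, mul_one, smul_add]
  match_scalars <;> apply Complex.ext <;> simp [d, r, s] <;> ring

end
end

section
/- Let n ≥ 1 and N = 2^n. For every N×N complex matrix U there exist real numbers c, indexed by functions i : Fin n → Fin 16, such that for all N×N complex matrices ρ: U ρ U† = Σ_i c_i · (V_{i(1)} ⊗ ⋯ ⊗ V_{i(n)}) ρ (V_{i(1)} ⊗ ⋯ ⊗ V_{i(n)})†, where V₁, …, V₁₆ are the Table-1 basis matrices and ⊗ is the Kronecker product. (The gate decomposition, Equation (6) of the paper, with D = 16^n.) -/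
open Matrix
open scoped Matrix Kronecker

noncomputable section

/-- The products of Pauli matrix entries with conjugate Pauli matrix entries span all
sesquilinear coefficient tensors on one qubit. -/
theorem exists_pauli_expansion (T : Fin 2 → Fin 2 → Fin 2 → Fin 2 → ℂ) :
    ∃ t : Fin 4 → Fin 4 → ℂ, ∀ i k j l,
      T i k j l = ∑ a, ∑ b, t a b * ((![1, PauliX, PauliY, PauliZ] a) i k *
        star ((![1, PauliX, PauliY, PauliZ] b) j l)) := by
  let P : Fin 4 → Matrix (Fin 2) (Fin 2) ℂ := ![1, PauliX, PauliY, PauliZ]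
  have hP (i k i' k' : Fin 2) : ∑ a, star (P a i k) * P a i' k' =
      if i = i' ∧ k = k' then 2 else 0 := by
    fin_cases i <;> fin_cases k <;> fin_cases i' <;> fin_cases k' <;>
      simp [P, Fin.sum_univ_succ, PauliX, PauliY, PauliZ] <;> norm_num
  have hP' (i k i' k' : Fin 2) : ∑ a, P a i k * star (P a i' k') =
      if i = i' ∧ k = k' then 2 else 0 := by
    have h := congrArg star (hP i k i' k')
    simpa [star_sum, apply_ite, mul_comm] using h
  refine ⟨fun a b =>
    (∑ i, ∑ k, ∑ j, ∑ l, T i k j l * (star (P a i k) * P b j l)) / 4, fun i k j l => ?_⟩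
  change _ = ∑ a, ∑ b, _ * (P a i k * star (P b j l))
  have key : ∑ a, ∑ b, (∑ i', ∑ k', ∑ j', ∑ l', T i' k' j' l' *
        (star (P a i' k') * P b j' l')) / 4 * (P a i k * star (P b j l)) =
      ∑ i', ∑ k', ∑ j', ∑ l', T i' k' j' l' / 4 *
        ((∑ a, star (P a i' k') * P a i k) * ∑ b, P b j' l' * star (P b j l)) := by
    simp only [Fin.sum_univ_two, Fin.sum_univ_four]
    ring
  rw [key]
  simp only [hP, hP']
  fin_cases i <;> fin_cases k <;> fin_cases j <;> fin_cases l <;>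
    simp [Fin.sum_univ_two] <;> ring

/-- Every sesquilinear coefficient tensor on one qubit is a combination of the tensors
`V ⊗ conj V`, with `V` ranging over the Table-1 basis. -/
theorem exists_tableV_expansion (T : Fin 2 → Fin 2 → Fin 2 → Fin 2 → ℂ) :
    ∃ c : Fin 16 → ℂ, ∀ i k j l,
      T i k j l = ∑ f, c f * (tableV f i k * star (tableV f j l)) := by
  obtain ⟨t, ht⟩ := exists_pauli_expansion T
  let s : Fin 4 → Fin 4 → ℂ := fun a b => (t a b + t b a) / 2
  let d : Fin 4 → Fin 4 → ℂ := fun a b => Complex.I * (t a b - t b a) / 2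
  let e : Fin 4 → Fin 4 → ℂ := fun a b => s a b + d a b
  have hr : ((Real.sqrt 2 : ℝ) : ℂ)⁻¹ * ((Real.sqrt 2 : ℝ) : ℂ)⁻¹ = 1 / 2 := by
    rw [← mul_inv, ← Complex.ofReal_mul, Real.mul_self_sqrt (by norm_num)]
    norm_num
  have hI : Complex.I * Complex.I = -1 := Complex.I_mul_I
  have h2 : (starRingEnd ℂ) 2 = 2 := Complex.conj_ofNat 2
  refine ⟨![t 0 0 - e 0 1 - e 0 2 - e 0 3, t 1 1 - e 0 1 - e 3 1 - e 1 2,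
    t 2 2 - e 0 2 - e 2 3 - e 1 2, t 3 3 - e 0 3 - e 2 3 - e 3 1,
    2 * d 0 1, 2 * d 0 2, 2 * d 0 3, 2 * s 2 3, 2 * s 3 1, 2 * s 1 2,
    4 * s 0 1, 4 * s 0 2, 4 * s 0 3, 4 * d 2 3, 4 * d 3 1, 4 * d 1 2], fun i k j l => ?_⟩
  rw [ht]
  simp [Fin.sum_univ_succ, tableV, e, s, d, h2]
  grind

theorem kronPow_succ_apply (n : ℕ) (g : Fin (n + 1) → Matrix (Fin 2) (Fin 2) ℂ)
    (a b : Fin (2 ^ (n + 1))) :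
    let φ := (finCongr (pow2mul (Nat.one_add n))).symm.trans
      (finProdFinEquiv (m := 2 ^ 1) (n := 2 ^ n)).symm
    kronPow (n + 1) g a b =
      g 0 (φ a).1 (φ b).1 * kronPow n (fun i => g i.succ) (φ a).2 (φ b).2 :=
  rfl

/-- The tensors `V ⊗ conj V`, with `V` ranging over the `n`-fold Kronecker products of the
Table-1 basis, span all sesquilinear coefficient tensors on `n` qubits. -/
theorem exists_kronPow_tableV_expansion (n : ℕ)
    (T : Fin (2 ^ n) → Fin (2 ^ n) → Fin (2 ^ n) → Fin (2 ^ n) → ℂ) :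
    ∃ c : (Fin n → Fin 16) → ℂ, ∀ i k j l,
      T i k j l = ∑ f, c f * (kronPow n (fun m => tableV (f m)) i k *
        star (kronPow n (fun m => tableV (f m)) j l)) := by
  induction n with
  | zero =>
    refine ⟨fun _ => T 0 0 0 0, fun i k j l => ?_⟩
    have h (x : Fin (2 ^ 0)) : x = 0 := Subsingleton.elim (α := Fin 1) x 0
    rw [h i, h k, h j, h l]
    simp [kronPow]
  | succ n ih =>
    let φ : Fin (2 ^ (n + 1)) ≃ Fin 2 × Fin (2 ^ n) :=
      (finCongr (pow2mul (Nat.one_add n))).symm.trans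
        (finProdFinEquiv (m := 2 ^ 1) (n := 2 ^ n)).symm
    have hone (i k j l : Fin (2 ^ n)) := exists_tableV_expansion fun a b x y =>
      T (φ.symm (a, i)) (φ.symm (b, k)) (φ.symm (x, j)) (φ.symm (y, l))
    choose c hc using hone
    choose d hd using fun v => ih fun i k j l => c i k j l v
    refine ⟨fun f => d (f 0) (fun m => f m.succ), fun i k j l => ?_⟩
    have h := hc (φ i).2 (φ k).2 (φ j).2 (φ l).2 (φ i).1 (φ k).1 (φ j).1 (φ l).1
    simp only [Prod.mk.eta, Equiv.symm_apply_apply] at h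
    rw [h, ← (Fin.consEquiv fun _ => Fin 16).sum_comp, Fintype.sum_prod_type]
    refine Finset.sum_congr rfl fun v _ => ?_
    rw [hd v, Finset.sum_mul]
    refine Finset.sum_congr rfl fun g _ => ?_
    simp only [kronPow_succ_apply, Fin.consEquiv_apply, Fin.cons_zero, Fin.cons_succ, star_mul']
    simp only [φ]
    ring

/-- the gate decomposition, Equation (6), with `D = 16^n`. -/
theorem stmt8 (n : ℕ) (hn : 1 ≤ n) (U : Matrix (Fin (2 ^ n)) (Fin (2 ^ n)) ℂ) :
    ∃ c : (Fin n → Fin 16) → ℝ, ∀ ρ : Matrix (Fin (2 ^ n)) (Fin (2 ^ n)) ℂ,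
      U * ρ * Uᴴ = ∑ f : Fin n → Fin 16,
        (c f : ℂ) • (kronPow n (fun k => tableV (f k)) * ρ *
          (kronPow n (fun k => tableV (f k)))ᴴ) := by
  obtain ⟨c, hc⟩ := exists_kronPow_tableV_expansion n fun i k j l => U i k * star (U j l)
  have hre (i k j l : Fin (2 ^ n)) : U i k * star (U j l) = ∑ f : Fin n → Fin 16, ((c f).re : ℂ) *
      (kronPow n (fun m => tableV (f m)) i k *
        star (kronPow n (fun m => tableV (f m)) j l)) := by
    have h := congrArg star (hc j l i k)
    simp only [star_sum, star_mul', star_star] at h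
    have h2 : U i k * star (U j l) = (U i k * star (U j l) + star (U j l) * U i k) / 2 := by
      ring
    rw [h2, h, hc i k j l, ← Finset.sum_add_distrib, Finset.sum_div]
    refine Finset.sum_congr rfl fun f _ => ?_
    rw [Complex.re_eq_add_conj, starRingEnd_apply]
    ring
  refine ⟨fun f => (c f).re, fun ρ => ?_⟩
  have entry (A : Matrix (Fin (2 ^ n)) (Fin (2 ^ n)) ℂ) (i j) :
      (A * ρ * Aᴴ) i j = ∑ l, ∑ k, A i k * star (A j l) * ρ k l := by
    simp only [Matrix.mul_apply, Finset.sum_mul, Matrix.conjTranspose_apply]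
    exact Finset.sum_congr rfl fun l _ => Finset.sum_congr rfl fun k _ => by ring
  ext i j
  simp only [Matrix.sum_apply, Matrix.smul_apply, entry, smul_eq_mul, Finset.mul_sum]
  conv_rhs => rw [Finset.sum_comm]
  refine Finset.sum_congr rfl fun l _ => ?_
  conv_rhs => rw [Finset.sum_comm]
  refine Finset.sum_congr rfl fun k _ => ?_
  rw [hre, Finset.sum_mul]
  exact Finset.sum_congr rfl fun f _ => by ring

end
end

section
/- Let T be the 8×8 Toffoli unitary matrix, which equals the identity matrix except that its (6,7) and (7,6) entries (0-based) are 1 and its (6,6) and (7,7) entries are 0. Then there exist real numbers c, indexed by triples (i₁,i₂,i₃) ∈ (Fin 16)³, such that Σ |c_{(i₁,i₂,i₃)}| = 37 and, for every 8×8 complex matrix ρ: T ρ T† = Σ_{(i₁,i₂,i₃)} c_{(i₁,i₂,i₃)} · (V_{i₁} ⊗ V_{i₂} ⊗ V_{i₃}) ρ (V_{i₁} ⊗ V_{i₂} ⊗ V_{i₃})†, where V₁, …, V₁₆ are the Table-1 basis matrices. -/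
open Matrix
open scoped Matrix Kronecker

noncomputable section

/-- The Toffoli gate: the `8 × 8` identity except that the `(6,7)` and `(7,6)` entries are `1`
and the `(6,6)` and `(7,7)` entries are `0` (0-based indices). -/
def Toffoli : Matrix (Fin 8) (Fin 8) ℂ := fun i j =>
  if ((i : ℕ) = 6 ∧ (j : ℕ) = 7) ∨ ((i : ℕ) = 7 ∧ (j : ℕ) = 6) then 1
  else if i = j ∧ (i : ℕ) ≠ 6 ∧ (i : ℕ) ≠ 7 then 1 else 0

/-- Three-qubit Kronecker product, as an `8 × 8` matrix. -/
def kron3 (A B C : Matrix (Fin 2) (Fin 2) ℂ) : Matrix (Fin 8) (Fin 8) ℂ := kron A (kron B C)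

/-- The projection onto the `-1` eigenspace of a Pauli matrix `P`. -/
def negProj (P : Matrix (Fin 2) (Fin 2) ℂ) : Matrix (Fin 2) (Fin 2) ℂ := (2 : ℂ)⁻¹ • (1 - P)

/-- The coefficient vector on the sixteen table entries with value `v 0` at the identity and values
`v 1`, `v 2`, `v 3` at the entries `z`, `p`, `s`. -/
def tableCoeff (z p s : Fin 16) (v : Fin 4 → ℤ) : Fin 16 → ℤ :=
  Pi.single 0 (v 0) + Pi.single z (v 1) + Pi.single p (v 2) + Pi.single s (v 3)

/-- Coefficients of the table entries `1`, `Z`, `(1 + Z) / 2`, `(1 + iZ) / √2`. -/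
def coeffZ : (Fin 4 → ℤ) → Fin 16 → ℤ := tableCoeff 3 12 6

/-- Coefficients of the table entries `1`, `X`, `(1 + X) / 2`, `(1 + iX) / √2`. -/
def coeffX : (Fin 4 → ℤ) → Fin 16 → ℤ := tableCoeff 1 10 4

/-- The identity channel. -/
def idVec : Fin 4 → ℤ := ![1, 0, 0, 0]

/-- Four times the symmetric part `ρ ↦ (Qρ + ρQ) / 2` of multiplication by the projection `Q`. -/
def symVec : Fin 4 → ℤ := ![3, 1, -4, 0]

/-- Four times the skew part `ρ ↦ (Qρ - ρQ) / (2i)` of multiplication by the projection `Q`. -/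
def skewVec : Fin 4 → ℤ := ![-1, -1, 0, 2]

/-- Four times the compression `ρ ↦ QρQ` by the projection `Q`. -/
def comprVec : Fin 4 → ℤ := ![2, 2, -4, 0]

/-- Sixteen times the coefficients of the Toffoli channel in the table basis. -/
def toffoliCoeff (t : Fin 16 × Fin 16 × Fin 16) : ℤ :=
  16 * (coeffZ idVec t.1 * coeffZ idVec t.2.1 * coeffX idVec t.2.2)
  - coeffZ symVec t.1 * coeffZ symVec t.2.1 * coeffX symVec t.2.2
  + coeffZ symVec t.1 * coeffZ skewVec t.2.1 * coeffX skewVec t.2.2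
  + coeffZ skewVec t.1 * coeffZ symVec t.2.1 * coeffX skewVec t.2.2
  + coeffZ skewVec t.1 * coeffZ skewVec t.2.1 * coeffX symVec t.2.2
  + coeffZ comprVec t.1 * coeffZ comprVec t.2.1 * coeffX comprVec t.2.2

theorem sum_abs_toffoliCoeff :
    ∑ t : Fin 16 × Fin 16 × Fin 16, |toffoliCoeff t| = 592 := by
  rw [Fintype.sum_prod_type]
  simp_rw [Fintype.sum_prod_type]
  decide +kernel

/-- The matrix of the superoperator `∑ i, w i • (V i * · * (V i)ᴴ)` on one qubit. -/
def superEntry (w : Fin 16 → ℤ) (p q r s : Fin 2) : ℂ :=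
  ∑ i, (w i : ℂ) * (tableV i p q * star (tableV i r s))

theorem superEntry_tableCoeff (z p s : Fin 16) (v : Fin 4 → ℤ) (a b c d : Fin 2) :
    superEntry (tableCoeff z p s v) a b c d =
      v 0 * (tableV 0 a b * star (tableV 0 c d)) + v 1 * (tableV z a b * star (tableV z c d))
      + v 2 * (tableV p a b * star (tableV p c d))
      + v 3 * (tableV s a b * star (tableV s c d)) := by
  simp [superEntry, tableCoeff, Pi.single_apply, add_mul, Finset.sum_add_distrib]

theorem inv_sqrt_two_mul_self :
    ((Real.sqrt 2 : ℝ) : ℂ)⁻¹ * ((Real.sqrt 2 : ℝ) : ℂ)⁻¹ = 2⁻¹ := by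
  rw [← mul_inv, ← Complex.ofReal_mul, Real.mul_self_sqrt (by norm_num)]
  norm_num

theorem inv_sqrt_two_entry_mul_star (A : Matrix (Fin 2) (Fin 2) ℂ) (a b c d : Fin 2) :
    (((Real.sqrt 2 : ℝ) : ℂ)⁻¹ • A) a b * star ((((Real.sqrt 2 : ℝ) : ℂ)⁻¹ • A) c d) =
      2⁻¹ * (A a b * star (A c d)) := by
  simp only [Matrix.smul_apply, smul_eq_mul, star_mul', Complex.star_def, map_inv₀,
    Complex.conj_ofReal]
  rw [← inv_sqrt_two_mul_self]
  ring

/-- The table holds the Pauli matrix `P`, the projection `(1 + P) / 2` and the rotation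
`(1 + iP) / √2` at the indices `z`, `p` and `s`. -/
structure IsPauliTriple (z p s : Fin 16) (P : Matrix (Fin 2) (Fin 2) ℂ) : Prop where
  pauli : tableV z = P
  proj : tableV p = (2 : ℂ)⁻¹ • (1 + P)
  rot : tableV s = ((Real.sqrt 2 : ℝ) : ℂ)⁻¹ • (1 + Complex.I • P)

theorem isPauliTriple_Z : IsPauliTriple 3 12 6 PauliZ := ⟨rfl, rfl, rfl⟩

theorem isPauliTriple_X : IsPauliTriple 1 10 4 PauliX := ⟨rfl, rfl, rfl⟩

section

variable {z p s : Fin 16} {P : Matrix (Fin 2) (Fin 2) ℂ}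

theorem IsPauliTriple.superEntry_eq (h : IsPauliTriple z p s P) (v : Fin 4 → ℤ)
    (a b c d : Fin 2) :
    let δ : Matrix (Fin 2) (Fin 2) ℂ := 1
    superEntry (tableCoeff z p s v) a b c d =
      v 0 * (δ a b * star (δ c d)) + v 1 * (P a b * star (P c d))
      + v 2 * (4⁻¹ * ((δ a b + P a b) * (star (δ c d) + star (P c d))))
      + v 3 * (2⁻¹ * ((δ a b + Complex.I * P a b)
          * (star (δ c d) - Complex.I * star (P c d)))) := by
  intro δ
  have h0 : tableV 0 = δ := rfl
  rw [superEntry_tableCoeff, h.rot, inv_sqrt_two_entry_mul_star, h.pauli, h.proj, h0]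
  simp only [Matrix.smul_apply, Matrix.add_apply, smul_eq_mul, star_mul', star_add,
    Complex.star_def, map_inv₀, Complex.conj_I, map_ofNat]
  ring

theorem IsPauliTriple.superEntry_idVec (h : IsPauliTriple z p s P) (a b c d : Fin 2) :
    superEntry (tableCoeff z p s idVec) a b c d =
      (1 : Matrix (Fin 2) (Fin 2) ℂ) a b * star ((1 : Matrix (Fin 2) (Fin 2) ℂ) c d) := by
  rw [h.superEntry_eq]
  simp only [idVec, Matrix.cons_val]
  push_cast
  ring

theorem IsPauliTriple.superEntry_symVec (h : IsPauliTriple z p s P) (a b c d : Fin 2) :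
    superEntry (tableCoeff z p s symVec) a b c d =
      2 * (negProj P a b * star ((1 : Matrix (Fin 2) (Fin 2) ℂ) c d)
        + (1 : Matrix (Fin 2) (Fin 2) ℂ) a b * star (negProj P c d)) := by
  rw [h.superEntry_eq]
  simp only [symVec, negProj, Matrix.smul_apply, Matrix.sub_apply, smul_eq_mul, star_mul', star_sub,
    Complex.star_def, map_inv₀, map_ofNat, Matrix.cons_val]
  push_cast
  ring

theorem IsPauliTriple.superEntry_skewVec (h : IsPauliTriple z p s P) (a b c d : Fin 2) :
    superEntry (tableCoeff z p s skewVec) a b c d =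
      -2 * Complex.I * (negProj P a b * star ((1 : Matrix (Fin 2) (Fin 2) ℂ) c d)
        - (1 : Matrix (Fin 2) (Fin 2) ℂ) a b * star (negProj P c d)) := by
  rw [h.superEntry_eq]
  simp only [skewVec, negProj, Matrix.smul_apply, Matrix.sub_apply, smul_eq_mul, star_mul',
    star_sub, Complex.star_def, map_inv₀, map_ofNat, Matrix.cons_val]
  push_cast
  linear_combination -(P a b * starRingEnd ℂ (P c d)) * Complex.I_mul_I

theorem IsPauliTriple.superEntry_comprVec (h : IsPauliTriple z p s P) (a b c d : Fin 2) :
    superEntry (tableCoeff z p s comprVec) a b c d =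
      4 * (negProj P a b * star (negProj P c d)) := by
  rw [h.superEntry_eq]
  simp only [comprVec, negProj, Matrix.smul_apply, Matrix.sub_apply, smul_eq_mul, star_mul',
    star_sub, Complex.star_def, map_inv₀, map_ofNat, Matrix.cons_val]
  push_cast
  ring

end

/-- The three bits of an index below `8`, most significant first. -/
def bit (i : Fin 8) : Fin 2 × Fin 2 × Fin 2 :=
  (Fin.divNat (m := 2) (n := 4) i, Fin.divNat (m := 2) (n := 2) (Fin.modNat (m := 2) (n := 4) i),
    Fin.modNat (m := 2) (n := 2) (Fin.modNat (m := 2) (n := 4) i))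

theorem kron3_apply (A B C : Matrix (Fin 2) (Fin 2) ℂ) (i j : Fin 8) :
    kron3 A B C i j =
      A (bit i).1 (bit j).1 * (B (bit i).2.1 (bit j).2.1 * C (bit i).2.2 (bit j).2.2) := rfl

theorem toffoli_eq :
    Toffoli = kron3 1 1 1 - (2 : ℂ) • kron3 (negProj PauliZ) (negProj PauliZ) (negProj PauliX) := by
  ext i j
  rw [Matrix.sub_apply, Matrix.smul_apply, kron3_apply, kron3_apply]
  fin_cases i <;> fin_cases j <;>
    simp [Toffoli, bit, Fin.divNat, Fin.modNat, negProj, PauliZ, PauliX, Matrix.one_apply] <;>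
    norm_num

theorem sum_mul_superEntry_mul (f g h : Fin 16 → ℤ) (i k j l : Fin 8) :
    ∑ t : Fin 16 × Fin 16 × Fin 16, ((f t.1 * g t.2.1 * h t.2.2 : ℤ) : ℂ) *
      (kron3 (tableV t.1) (tableV t.2.1) (tableV t.2.2) i k *
        star (kron3 (tableV t.1) (tableV t.2.1) (tableV t.2.2) j l)) =
      superEntry f (bit i).1 (bit k).1 (bit j).1 (bit l).1 *
        (superEntry g (bit i).2.1 (bit k).2.1 (bit j).2.1 (bit l).2.1 *
          superEntry h (bit i).2.2 (bit k).2.2 (bit j).2.2 (bit l).2.2) := by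
  simp only [superEntry, Fintype.sum_prod_type, kron3_apply, star_mul']
  rw [Finset.sum_mul_sum, Finset.sum_mul_sum]
  simp only [Finset.mul_sum]
  refine Finset.sum_congr rfl fun a _ => Finset.sum_congr rfl fun b _ =>
    Finset.sum_congr rfl fun c _ => ?_
  push_cast
  ring

theorem toffoli_mul_star_toffoli (i k j l : Fin 8) :
    Toffoli i k * star (Toffoli j l) = ∑ t : Fin 16 × Fin 16 × Fin 16,
      (toffoliCoeff t : ℂ) / 16 * (kron3 (tableV t.1) (tableV t.2.1) (tableV t.2.2) i k *
        star (kron3 (tableV t.1) (tableV t.2.1) (tableV t.2.2) j l)) := by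
  have key := fun f g h => sum_mul_superEntry_mul f g h i k j l
  have expand : ∀ t : Fin 16 × Fin 16 × Fin 16, ∀ x : ℂ, (toffoliCoeff t : ℂ) / 16 * x =
      ((coeffZ idVec t.1 * coeffZ idVec t.2.1 * coeffX idVec t.2.2 : ℤ) : ℂ) * x
      - 16⁻¹ * (((coeffZ symVec t.1 * coeffZ symVec t.2.1 * coeffX symVec t.2.2 : ℤ) : ℂ) * x)
      + 16⁻¹ * (((coeffZ symVec t.1 * coeffZ skewVec t.2.1 * coeffX skewVec t.2.2 : ℤ) : ℂ) * x)
      + 16⁻¹ * (((coeffZ skewVec t.1 * coeffZ symVec t.2.1 * coeffX skewVec t.2.2 : ℤ) : ℂ) * x)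
      + 16⁻¹ * (((coeffZ skewVec t.1 * coeffZ skewVec t.2.1 * coeffX symVec t.2.2 : ℤ) : ℂ) * x)
      + 16⁻¹ *
        (((coeffZ comprVec t.1 * coeffZ comprVec t.2.1 * coeffX comprVec t.2.2 : ℤ) : ℂ) * x) := by
    intro t x
    simp only [toffoliCoeff]
    push_cast
    ring
  simp only [expand, Finset.sum_add_distrib, Finset.sum_sub_distrib, ← Finset.mul_sum, key]
  simp only [coeffZ, coeffX, isPauliTriple_Z.superEntry_idVec, isPauliTriple_X.superEntry_idVec,
    isPauliTriple_Z.superEntry_symVec, isPauliTriple_X.superEntry_symVec,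
    isPauliTriple_Z.superEntry_skewVec, isPauliTriple_X.superEntry_skewVec,
    isPauliTriple_Z.superEntry_comprVec, isPauliTriple_X.superEntry_comprVec,
    toffoli_eq, Matrix.sub_apply, Matrix.smul_apply, kron3_apply, smul_eq_mul, star_sub, star_mul']
  rw [show star (2 : ℂ) = 2 from map_ofNat (starRingEnd ℂ) 2]
  generalize (1 : Matrix (Fin 2) (Fin 2) ℂ) (bit i).1 (bit k).1 = x₁
  generalize (1 : Matrix (Fin 2) (Fin 2) ℂ) (bit i).2.1 (bit k).2.1 = x₂
  generalize (1 : Matrix (Fin 2) (Fin 2) ℂ) (bit i).2.2 (bit k).2.2 = x₃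
  generalize star ((1 : Matrix (Fin 2) (Fin 2) ℂ) (bit j).1 (bit l).1) = y₁
  generalize star ((1 : Matrix (Fin 2) (Fin 2) ℂ) (bit j).2.1 (bit l).2.1) = y₂
  generalize star ((1 : Matrix (Fin 2) (Fin 2) ℂ) (bit j).2.2 (bit l).2.2) = y₃
  generalize negProj PauliZ (bit i).1 (bit k).1 = u₁
  generalize negProj PauliZ (bit i).2.1 (bit k).2.1 = u₂
  generalize negProj PauliX (bit i).2.2 (bit k).2.2 = u₃
  generalize star (negProj PauliZ (bit j).1 (bit l).1) = w₁
  generalize star (negProj PauliZ (bit j).2.1 (bit l).2.1) = w₂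
  generalize star (negProj PauliX (bit j).2.2 (bit l).2.2) = w₃
  ring_nf
  rw [Complex.I_sq]
  ring

theorem mul_mul_conjTranspose_apply (A ρ : Matrix (Fin 8) (Fin 8) ℂ) (i j : Fin 8) :
    (A * ρ * Aᴴ) i j = ∑ l, ∑ k, A i k * star (A j l) * ρ k l := by
  simp only [Matrix.mul_apply, Matrix.conjTranspose_apply, Finset.sum_mul]
  exact Finset.sum_congr rfl fun l _ => Finset.sum_congr rfl fun k _ => by ring

/-- the gate decomposition of the Toffoli gate, with sampling overhead 37. -/
theorem stmt10 :
    ∃ c : Fin 16 × Fin 16 × Fin 16 → ℝ,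
      (∑ t : Fin 16 × Fin 16 × Fin 16, |c t|) = 37
      ∧ ∀ ρ : Matrix (Fin 8) (Fin 8) ℂ,
          Toffoli * ρ * Toffoliᴴ = ∑ t : Fin 16 × Fin 16 × Fin 16,
            (c t : ℂ) • (kron3 (tableV t.1) (tableV t.2.1) (tableV t.2.2) * ρ *
              (kron3 (tableV t.1) (tableV t.2.1) (tableV t.2.2))ᴴ) := by
  refine ⟨fun t => (toffoliCoeff t : ℝ) / 16, ?_, fun ρ => ?_⟩
  · simp only [abs_div, ← Int.cast_abs, ← Finset.sum_div, ← Int.cast_sum, sum_abs_toffoliCoeff]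
    norm_num
  · ext i j
    simp only [Matrix.sum_apply, Matrix.smul_apply, mul_mul_conjTranspose_apply, smul_eq_mul,
      toffoli_mul_star_toffoli, Finset.sum_mul, Finset.mul_sum]
    refine (Finset.sum_congr rfl fun l _ => Finset.sum_comm).trans (Finset.sum_comm.trans ?_)
    refine Finset.sum_congr rfl fun t _ => Finset.sum_congr rfl fun l _ =>
      Finset.sum_congr rfl fun k _ => ?_
    push_cast
    ring

end
end
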